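/- arXiv:2105.05942 — 2 statements merged into one kernel-verified Lean document; each statement's English description precedes it below -/
import Mathlib

section
/- Let k and T be positive integers, let K_1, …, K_T be k×k complex matrices, and let δ_0 ∈ ℂ. Recursively define, for 1 ≤ i ≤ T, the matrices Δ_{i−1} = (δ_{i−1}/k) · I (where I is the k×k identity matrix) and the scalars δ_i = trace(Δ_{i−1} · K_i). Then for every 1 ≤ i ≤ T one has trace(Δ_i) = trace(Δ_{i−1} · K_i), where Δ_i = (δ_i/k) · I, and moreover δ_T = δ_0 · Π_{i=1}^{T} (trace(K_i)/k). -/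
open Finset

/-- The cheating strategy against the relaxed AG protocol: choosing each error matrix
`Δ i = (δ i / k) • I` makes every round's exact consistency check pass, while the error
value shrinks by the factor `trace (K i) / k` at round `i`. -/
theorem cheating_strategy_identity
    (k T : ℕ) (hk : 0 < k) (hT : 0 < T)
    (K : ℕ → Matrix (Fin k) (Fin k) ℂ)
    (δ₀ : ℂ) (δ : ℕ → ℂ)
    (hδ0 : δ 0 = δ₀)
    (hrec : ∀ i, 1 ≤ i → i ≤ T →
      δ i = Matrix.trace (((δ (i - 1) / (k : ℂ)) • (1 : Matrix (Fin k) (Fin k) ℂ)) * K i)) :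
    (∀ i, 1 ≤ i → i ≤ T →
        Matrix.trace ((δ i / (k : ℂ)) • (1 : Matrix (Fin k) (Fin k) ℂ)) =
          Matrix.trace (((δ (i - 1) / (k : ℂ)) • (1 : Matrix (Fin k) (Fin k) ℂ)) * K i)) ∧
      δ T = δ₀ * ∏ i ∈ Icc 1 T, (Matrix.trace (K i) / (k : ℂ)) := by
  have hk' : (k : ℂ) ≠ 0 := Nat.cast_ne_zero.mpr hk.ne'
  refine ⟨fun i h1 hi => ?_, ?_⟩
  · rw [← hrec i h1 hi, Matrix.trace_smul, Matrix.trace_one, Fintype.card_fin, smul_eq_mul,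
      div_mul_cancel₀ _ hk']
  · have key : ∀ n ≤ T, δ n = δ₀ * ∏ i ∈ Icc 1 n, (Matrix.trace (K i) / (k : ℂ)) := by
      intro n
      induction n with
      | zero => simp [hδ0]
      | succ n ih =>
        intro hn
        rw [hrec (n + 1) (by lia) hn, Nat.add_sub_cancel, ih (by lia),
          Finset.prod_Icc_succ_top (by lia), smul_mul_assoc, one_mul, Matrix.trace_smul,
          smul_eq_mul]
        ring
    exact key T le_rfl
end

section
/- For angles θ, φ₁, φ₂ ∈ ℝ, let u(θ, φ₁, φ₂) denote the 2×2 complex matrix with rows (cos θ · e^{iφ₁}, sin θ · e^{iφ₂}) and (−sin θ · e^{−iφ₂}, cos θ · e^{−iφ₁}). Let B be a 2×2 complex matrix with trace(B) ≠ 0. Then the set {(θ, φ₁, φ₂) ∈ [0, 2π]³ : trace(B · u(θ, φ₁, φ₂)) = 0} has Lebesgue measure zero; equivalently, if θ, φ₁, φ₂ are chosen independently and uniformly at random from [0, 2π] (the measure U(2) on single-qubit unitaries), then trace(B · u(θ, φ₁, φ₂)) = 0 with probability 0. -/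
open MeasureTheory Real

/-- The random single-qubit unitary of the measure `U(2)`:
rows `(cos θ · e^{iφ₁}, sin θ · e^{iφ₂})` and `(−sin θ · e^{−iφ₂}, cos θ · e^{−iφ₁})`. -/
noncomputable def randomUnitary (θ φ₁ φ₂ : ℝ) : Matrix (Fin 2) (Fin 2) ℂ :=
  !![(Real.cos θ : ℂ) * Complex.exp (Complex.I * φ₁),
      (Real.sin θ : ℂ) * Complex.exp (Complex.I * φ₂);
    -(Real.sin θ : ℂ) * Complex.exp (-(Complex.I * φ₂)),
      (Real.cos θ : ℂ) * Complex.exp (-(Complex.I * φ₁))]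

open scoped ContDiff in
theorem ContDiff.ae_ne_zero {f : ℝ → ℂ} (hf : ContDiff ℝ ω f) {x₀ : ℝ} (h₀ : f x₀ ≠ 0) :
    ∀ᵐ x, f x ≠ 0 := by
  have hf' : AnalyticOnNhd ℝ f Set.univ := fun x _ => hf.contDiffAt.analyticAt
  rcases hf'.eqOn_zero_or_eventually_ne_zero_of_preconnected isPreconnected_univ with h | h
  · exact absurd (h (Set.mem_univ x₀)) h₀
  · rw [← Measure.restrict_univ (μ := volume)]
    exact ae_restrict_le_codiscreteWithin MeasurableSet.univ h

theorem trace_mul_randomUnitary (B : Matrix (Fin 2) (Fin 2) ℂ) (θ φ₁ φ₂ : ℝ) :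
    Matrix.trace (B * randomUnitary θ φ₁ φ₂) =
      Real.cos θ * (B 0 0 * Complex.exp (Complex.I * φ₁) +
          B 1 1 * Complex.exp (-(Complex.I * φ₁))) +
        Real.sin θ * (B 1 0 * Complex.exp (Complex.I * φ₂) -
          B 0 1 * Complex.exp (-(Complex.I * φ₂))) := by
  simp only [randomUnitary, Matrix.trace_fin_two, Matrix.mul_apply, Fin.sum_univ_two,
    Matrix.of_apply, Matrix.cons_val', Matrix.cons_val_zero, Matrix.cons_val_one,
    Matrix.cons_val_fin_one]
  ring

theorem contDiff_cos_mul_add_sin_mul (n : WithTop ℕ∞) (c d : ℂ) :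
    ContDiff ℝ n fun θ : ℝ => (Real.cos θ : ℂ) * c + Real.sin θ * d :=
  ((Complex.ofRealCLM.contDiff.comp Real.contDiff_cos).mul contDiff_const).add
    ((Complex.ofRealCLM.contDiff.comp Real.contDiff_sin).mul contDiff_const)

theorem contDiff_mul_exp_add_mul_exp_neg (n : WithTop ℕ∞) (a d : ℂ) :
    ContDiff ℝ n fun φ : ℝ =>
      a * Complex.exp (Complex.I * φ) + d * Complex.exp (-(Complex.I * φ)) := by
  have h : ContDiff ℝ n fun φ : ℝ => Complex.I * (φ : ℂ) :=
    contDiff_const.mul Complex.ofRealCLM.contDiff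
  exact (contDiff_const.mul h.cexp).add (contDiff_const.mul h.neg.cexp)

theorem ae_trace_mul_randomUnitary_ne_zero
    (B : Matrix (Fin 2) (Fin 2) ℂ) (hB : Matrix.trace B ≠ 0) :
    ∀ᵐ p : ℝ × ℝ × ℝ, Matrix.trace (B * randomUnitary p.1 p.2.1 p.2.2) ≠ 0 := by
  have hmeas : MeasurableSet
      {p : ℝ × ℝ × ℝ | Matrix.trace (B * randomUnitary p.1 p.2.1 p.2.2) = 0} := by
    simp only [trace_mul_randomUnitary]
    exact (isClosed_eq (by fun_prop) continuous_const).measurableSet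
  simp only [ae_iff, not_not]
  rw [Measure.volume_eq_prod, Measure.prod_apply_symm hmeas,
    lintegral_eq_zero_iff (measurable_measure_prodMk_right hmeas)]
  have hφ : ∀ᵐ φ : ℝ, B 0 0 * Complex.exp (Complex.I * φ) +
      B 1 1 * Complex.exp (-(Complex.I * φ)) ≠ 0 := by
    refine (contDiff_mul_exp_add_mul_exp_neg _ _ _).ae_ne_zero (x₀ := 0) ?_
    simpa [Matrix.trace_fin_two] using hB
  have hq : ∀ᵐ q : ℝ × ℝ, B 0 0 * Complex.exp (Complex.I * q.1) +
      B 1 1 * Complex.exp (-(Complex.I * q.1)) ≠ 0 :=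
    Measure.quasiMeasurePreserving_fst.ae hφ
  filter_upwards [hq] with q hq
  have hθ := (contDiff_cos_mul_add_sin_mul _ (B 0 0 * Complex.exp (Complex.I * q.1) +
      B 1 1 * Complex.exp (-(Complex.I * q.1))) (B 1 0 * Complex.exp (Complex.I * q.2) -
      B 0 1 * Complex.exp (-(Complex.I * q.2)))).ae_ne_zero (x₀ := 0) (by simpa using hq)
  simp only [ae_iff, not_not, ← trace_mul_randomUnitary] at hθ
  exact hθ

/-- Error-forwarding fact for the AG protocol: if `trace B ≠ 0`, then the set of angle
triples `(θ, φ₁, φ₂) ∈ [0, 2π]³` for which `trace (B · u(θ, φ₁, φ₂)) = 0` has Lebesgue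
measure zero, i.e. a random `U(2)` unitary kills the error value with probability `0`. -/
theorem trace_vanishing_set_measure_zero
    (B : Matrix (Fin 2) (Fin 2) ℂ) (hB : Matrix.trace B ≠ 0) :
    volume {p : ℝ × ℝ × ℝ |
        p.1 ∈ Set.Icc 0 (2 * π) ∧ p.2.1 ∈ Set.Icc 0 (2 * π) ∧ p.2.2 ∈ Set.Icc 0 (2 * π) ∧
        Matrix.trace (B * randomUnitary p.1 p.2.1 p.2.2) = 0} = 0 := by
  refine measure_mono_null (fun p hp => ?_)
    (ae_iff.1 (ae_trace_mul_randomUnitary_ne_zero B hB))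
  exact not_not.2 hp.2.2.2
end
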